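/- arXiv:1509.06434 — 6 statements merged into one kernel-verified Lean document; each statement's English description precedes it below -/
import Mathlib

section
/- Let G = (V,E) be a simple connected undirected graph in which every vertex has degree at most 3 and every vertex of degree exactly 3 is a cut vertex. Then there exists a chordal graph G' = (V,E') on the same vertex set with E ⊆ E' whose clique number is at most 3; in particular, the treewidth of G is at most 2. -/
/-- A cut vertex: a vertex whose removal disconnects the graph. -/
def IsCutVertex {α : Type*} (G : SimpleGraph α) (v : α) : Prop :=
  ¬ (SimpleGraph.induce ({v}ᶜ : Set α) G).Connected

/-- A cycle of a graph has a chord if some edge of the graph connects two vertices of the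
cycle that are not consecutive in it. -/
def HasChord {α : Type*} (G : SimpleGraph α) {u : α} (c : G.Walk u u) : Prop :=
  ∃ x ∈ c.support, ∃ y ∈ c.support, G.Adj x y ∧ s(x, y) ∉ c.edges

/-- A graph is chordal if every cycle of length `4` or more has a chord. -/
def Chordal {α : Type*} (G : SimpleGraph α) : Prop :=
  ∀ (u : α) (c : G.Walk u u), c.IsCycle → 4 ≤ c.length → HasChord G c

namespace SimpleGraph

variable {α : Type*} {G H : SimpleGraph α}

/-- A cycle passes through both neighbors of a vertex of degree at most two lying on it, and
these neighbors are not consecutive unless the cycle is a triangle. -/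
theorem Walk.IsCycle.neighbors_mem_support {u v a b : α} {c : G.Walk u u} (hc : c.IsCycle)
    (hlen : 4 ≤ c.length) (hv : v ∈ c.support) (hN : ∀ w, G.Adj v w → w = a ∨ w = b) :
    a ∈ c.support ∧ b ∈ c.support ∧ s(a, b) ∉ c.edges := by
  classical
  have hd : (c.rotate v hv).IsCycle := hc.rotate hv
  have hdlen : 4 ≤ (c.rotate v hv).length := by simpa using hlen
  have hsupp : ∀ x, x ∈ (c.rotate v hv).support → x ∈ c.support := fun x hx ↦
    (mem_support_rotate_iff c v hv).1 hx
  have hedge : ∀ e, e ∈ c.edges → e ∈ (c.rotate v hv).edges := fun e he ↦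
    (c.rotate_edges v hv).mem_iff.2 he
  generalize c.rotate v hv = d at hd hdlen hsupp hedge
  have h1 := d.adj_snd hd.not_nil
  have h2 := (d.adj_penultimate hd.not_nil).symm
  have hne := hd.snd_ne_penultimate
  have hs1 := hsupp _ (d.getVert_mem_support 1)
  have hs2 := hsupp _ (d.getVert_mem_support (d.length - 1))
  have hnot : s(d.snd, d.penultimate) ∉ d.edges := by
    rw [mk_mem_edges_iff_exists]
    rintro ⟨i, hi, h⟩
    have inj := hd.getVert_injOn
    have inj' := hd.getVert_injOn'
    rcases Sym2.eq_iff.1 h with ⟨h3, h4⟩ | ⟨h3, h4⟩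
    · have e1 : i = 1 := inj' (by simp; lia) (by simp; lia) h3
      have e2 : i + 1 = d.length - 1 := inj (by simp; lia) (by simp; lia) h4
      lia
    · have e1 : i = d.length - 1 := inj' (by simp; lia) (by simp) h3
      have e2 : i + 1 = 1 := inj (by simp; lia) (by simp; lia) h4
      lia
  have hnot' : s(d.snd, d.penultimate) ∉ c.edges := fun h ↦ hnot (hedge _ h)
  rcases hN _ h1 with h3 | h3 <;> rcases hN _ h2 with h4 | h4
  · exact absurd (h3.trans h4.symm) hne
  · rw [← h3, ← h4]; exact ⟨hs1, hs2, hnot'⟩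
  · rw [← h3, ← h4, Sym2.eq_swap]; exact ⟨hs2, hs1, hnot'⟩
  · exact absurd (h3.trans h4.symm) hne

theorem _root_.Chordal.hasChord_of_edges_subset (hH : Chordal H) (hle : H ≤ G) {u : α}
    {c : G.Walk u u} (hc : c.IsCycle) (hlen : 4 ≤ c.length) (he : ∀ e ∈ c.edges, e ∈ H.edgeSet) :
    HasChord G c := by
  obtain ⟨x, hx, y, hy, hxy, hn⟩ := hH u (c.transfer H he) (hc.transfer he) (by simpa using hlen)
  exact ⟨x, by simpa using hx, y, by simpa using hy, hle hxy, by simpa using hn⟩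

/-- A walk ending at `v` reaches some neighbor of `v` before visiting `v`. -/
theorem Walk.exists_adj_reachable_induce_compl (hle : H ≤ G) {x v : α} (p : H.Walk x v)
    (hx : x ≠ v) : ∃ n, ∃ hn : n ≠ v, H.Adj n v ∧
      (G.induce ({v}ᶜ : Set α)).Reachable ⟨x, hx⟩ ⟨n, hn⟩ := by
  induction p with
  | nil => exact absurd rfl hx
  | @cons x y v h p ih =>
    by_cases hy : y = v
    · subst hy
      exact ⟨x, hx, h, .rfl⟩
    · obtain ⟨n, hn, hadj, hr⟩ := ih hy
      refine ⟨n, hn, hadj, Reachable.trans (Adj.reachable ?_) hr⟩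
      exact hle h

/-- A cut vertex with at most three neighbors is incident to a bridge. -/
theorem exists_isBridge_of_isCutVertex (hconn : G.Connected) {v a b c : α}
    (hN : ∀ w, G.Adj v w ↔ w = a ∨ w = b ∨ w = c) (hcut : IsCutVertex G v) :
    ∃ w, G.Adj v w ∧ G.IsBridge s(v, w) := by
  by_contra! hno
  have hne : ∀ w, G.Adj v w → w ≠ v := fun w h ↦ h.ne'
  have key : ∀ w (h : G.Adj v w), ∃ n, ∃ hn : G.Adj v n, n ≠ w ∧
      (G.induce ({v}ᶜ : Set α)).Reachable ⟨w, hne w h⟩ ⟨n, hne n hn⟩ := by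
    intro w h
    have := hno w h
    rw [isBridge_iff, not_not] at this
    obtain ⟨p⟩ := this.symm
    obtain ⟨n, hn, hadj, hr⟩ := p.exists_adj_reachable_induce_compl (deleteEdges_le _) h.ne'
    rw [deleteEdges_adj] at hadj
    refine ⟨n, hadj.1.symm, ?_, hr⟩
    rintro rfl
    exact hadj.2 Sym2.eq_swap
  have ha : G.Adj v a := (hN a).2 (by simp)
  have hb : G.Adj v b := (hN b).2 (by simp)
  have hc : G.Adj v c := (hN c).2 (by simp)
  have hall : ∀ w (h : G.Adj v w),
      (G.induce ({v}ᶜ : Set α)).Reachable ⟨w, hne w h⟩ ⟨a, hne a ha⟩ := by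
    obtain ⟨x, hx, hxa, rx⟩ := key a ha
    obtain ⟨y, hy, hyb, ry⟩ := key b hb
    obtain ⟨z, hz, hzc, rz⟩ := key c hc
    have rbc : (G.induce ({v}ᶜ : Set α)).Reachable ⟨b, hne b hb⟩ ⟨a, hne a ha⟩ ∧
        (G.induce ({v}ᶜ : Set α)).Reachable ⟨c, hne c hc⟩ ⟨a, hne a ha⟩ := by
      rcases (hN x).1 hx with rfl | rfl | rfl
      · exact absurd rfl hxa
      · refine ⟨rx.symm, ?_⟩
        rcases (hN z).1 hz with rfl | rfl | rfl
        · exact rz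
        · exact rz.trans rx.symm
        · exact absurd rfl hzc
      · refine ⟨?_, rx.symm⟩
        rcases (hN y).1 hy with rfl | rfl | rfl
        · exact ry
        · exact absurd rfl hyb
        · exact ry.trans rx.symm
    intro w h
    rcases (hN w).1 h with rfl | rfl | rfl
    exacts [.rfl, rbc.1, rbc.2]
  refine hcut ((connected_iff_exists_forall_reachable _).2 ⟨⟨a, hne a ha⟩, ?_⟩)
  rintro ⟨x, hx⟩
  obtain ⟨p⟩ := hconn.preconnected x v
  obtain ⟨n, hn, hadj, hr⟩ := p.exists_adj_reachable_induce_compl le_rfl hx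
  exact (hr.trans (hall n hadj.symm)).symm

/-- `G'` is a chordal supergraph of `G` with cliques of size at most three and the same
connected components. -/
structure IsComponentwiseTriangulation (G G' : SimpleGraph α) : Prop where
  le : G ≤ G'
  reachable_of_adj : ∀ x y, G'.Adj x y → G.Reachable x y
  chordal : Chordal G'
  card_le : ∀ s : Finset α, G'.IsClique (s : Set α) → s.card ≤ 3

theorem IsComponentwiseTriangulation.reachable {G' : SimpleGraph α}
    (h : IsComponentwiseTriangulation G G') {x y : α} (hr : G'.Reachable x y) :
    G.Reachable x y := by
  obtain ⟨p⟩ := hr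
  induction p with
  | nil => rfl
  | cons e _ ih => exact (h.reachable_of_adj _ _ e).trans ih

/-- Adding a bridge back to a triangulation of the graph without it. -/
theorem IsComponentwiseTriangulation.sup_bridge {G' : SimpleGraph α} {u v : α} (huv : G.Adj u v)
    (hbr : G.IsBridge s(u, v))
    (h : IsComponentwiseTriangulation (G.deleteEdges {s(u, v)}) G') :
    IsComponentwiseTriangulation G (G' ⊔ edge u v) := by
  have hnr : ¬ G'.Reachable u v := fun hr ↦ isBridge_iff.1 hbr (h.reachable hr)
  have hbr' : (G' ⊔ edge u v).IsBridge s(u, v) :=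
    isBridge_sup_edge.2 (IsBridge.of_not_reachable hnr)
  have hcases : ∀ x y, (G' ⊔ edge u v).Adj x y → s(x, y) ≠ s(u, v) → G'.Adj x y := by
    intro x y hxy hn
    rw [sup_adj, edge_adj] at hxy
    rcases hxy with hxy | ⟨hxy, -⟩
    · exact hxy
    · exact absurd (Sym2.eq_iff.2 hxy) hn
  refine ⟨?_, ?_, ?_, ?_⟩
  · intro x y hxy
    by_cases he : s(x, y) = s(u, v)
    · exact Or.inr (edge_adj .. |>.2 ⟨Sym2.eq_iff.1 he, hxy.ne⟩)
    · exact Or.inl (h.le (deleteEdges_adj.2 ⟨hxy, he⟩))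
  · intro x y hxy
    by_cases he : s(x, y) = s(u, v)
    · refine Adj.reachable ?_
      rw [← mem_edgeSet] at huv ⊢
      rwa [he]
    · exact (h.reachable_of_adj _ _ (hcases x y hxy he)).mono (deleteEdges_le _)
  · intro w c hc hlen
    refine h.chordal.hasChord_of_edges_subset le_sup_left hc hlen fun e he ↦ ?_
    have hne : e ≠ s(u, v) := by
      rintro rfl
      exact hbr'.notMem_edges_of_isCycle hc he
    have hmem := c.edges_subset_edgeSet he
    induction e with
    | h x y => exact hcases x y hmem hne
  · intro s hs
    by_cases hmem : u ∈ s ∧ v ∈ s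
    · have hsub : ∀ w ∈ s, w = u ∨ w = v := by
        intro w hw
        by_contra! hn
        refine hnr (Reachable.trans (v := w) (Adj.reachable ?_) (Adj.reachable ?_))
        · refine hcases _ _ (hs hmem.1 hw hn.1.symm) ?_
          grind [Sym2.eq_iff]
        · refine hcases _ _ (hs hw hmem.2 hn.2) ?_
          grind [Sym2.eq_iff]
      classical
      have : s ⊆ {u, v} := fun w hw ↦ by simpa using hsub w hw
      exact (Finset.card_le_card this).trans (Finset.card_le_two.trans (by norm_num))
    · refine h.card_le s fun x hx y hy hxy ↦ hcases x y (hs hx hy hxy) ?_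
      rintro he
      rcases Sym2.eq_iff.1 he with ⟨rfl, rfl⟩ | ⟨rfl, rfl⟩
      exacts [hmem ⟨hx, hy⟩, hmem ⟨hy, hx⟩]

/-- Remove all edges at `v` and join `a` to `b` instead. -/
def eliminate (G : SimpleGraph α) (v a b : α) : SimpleGraph α :=
  G.deleteEdges {e | v ∈ e} ⊔ edge a b

theorem eliminate_adj {v a b x y : α} : (G.eliminate v a b).Adj x y ↔
    (G.Adj x y ∧ x ≠ v ∧ y ≠ v) ∨ ((x = a ∧ y = b ∨ x = b ∧ y = a) ∧ x ≠ y) := by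
  simp only [eliminate, sup_adj, deleteEdges_adj, edge_adj, Set.mem_ofPred_eq, Sym2.mem_iff]
  grind

/-- Adding a vertex of degree at most two back to a triangulation of the graph from which it
was eliminated. -/
theorem IsComponentwiseTriangulation.sup_of_eliminate {G' : SimpleGraph α} {v a b : α}
    (hva : G.Adj v a) (hvb : G.Adj v b) (hN : ∀ w, G.Adj v w → w = a ∨ w = b)
    (h : IsComponentwiseTriangulation (G.eliminate v a b) G') :
    IsComponentwiseTriangulation G (G' ⊔ edge v a ⊔ edge v b) := by
  have hav := hva.ne'
  have hbv := hvb.ne'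
  have hiso : ∀ x, ¬ G'.Adj v x := by
    intro x hx
    obtain ⟨p⟩ := h.reachable_of_adj v x hx
    cases p with
    | nil => exact hx.ne rfl
    | cons e _ =>
      rw [eliminate_adj] at e
      grind
  have hadj : ∀ x y, (G' ⊔ edge v a ⊔ edge v b).Adj x y ↔ G'.Adj x y ∨
      (x = v ∧ (y = a ∨ y = b)) ∨ (y = v ∧ (x = a ∨ x = b)) := by
    intro x y
    simp only [sup_adj, edge_adj]
    grind
  have hN' : ∀ w, (G' ⊔ edge v a ⊔ edge v b).Adj v w → w = a ∨ w = b := by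
    intro w hw
    have := hiso w
    rw [hadj] at hw
    grind
  have hcases : ∀ x y, x ≠ v → y ≠ v → (G' ⊔ edge v a ⊔ edge v b).Adj x y → G'.Adj x y := by
    intro x y hx hy hxy
    rw [hadj] at hxy
    grind
  have hab : a ≠ b → G'.Adj a b := fun hne ↦ h.le (eliminate_adj.2 (by grind))
  refine ⟨?_, ?_, ?_, ?_⟩
  · intro x y hxy
    rw [hadj]
    by_cases hx : x = v
    · subst hx; exact Or.inr (Or.inl ⟨rfl, hN y hxy⟩)
    by_cases hy : y = v
    · subst hy; exact Or.inr (Or.inr ⟨rfl, hN x hxy.symm⟩)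
    exact Or.inl (h.le (eliminate_adj.2 (Or.inl ⟨hxy, hx, hy⟩)))
  · have hred : ∀ x y, (G.eliminate v a b).Reachable x y → G.Reachable x y := by
      rintro x y ⟨p⟩
      induction p with
      | nil => rfl
      | cons e _ ih =>
        refine Reachable.trans ?_ ih
        rcases eliminate_adj.1 e with ⟨e, -⟩ | ⟨⟨rfl, rfl⟩ | ⟨rfl, rfl⟩, -⟩
        · exact e.reachable
        · exact hva.symm.reachable.trans hvb.reachable
        · exact hvb.symm.reachable.trans hva.reachable
    intro x y hxy
    rcases (hadj x y).1 hxy with e | ⟨rfl, rfl | rfl⟩ | ⟨rfl, rfl | rfl⟩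
    exacts [hred _ _ (h.reachable_of_adj _ _ e), hva.reachable, hvb.reachable,
      hva.symm.reachable, hvb.symm.reachable]
  · intro w c hc hlen
    by_cases hv : v ∈ c.support
    · obtain ⟨ha, hb, hn⟩ := hc.neighbors_mem_support hlen hv hN'
      refine ⟨a, ha, b, hb, (hadj a b).2 (Or.inl (hab ?_)), hn⟩
      rintro rfl
      classical
      have hd := hc.rotate hv
      have h1 := hN' _ (Walk.adj_snd hd.not_nil)
      have h2 := hN' _ (Walk.adj_penultimate hd.not_nil).symm
      exact hd.snd_ne_penultimate (by grind)
    · refine h.chordal.hasChord_of_edges_subset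
        (fun x y hxy ↦ (hadj x y).2 (Or.inl hxy)) hc hlen fun e he ↦ ?_
      have hmem := c.edges_subset_edgeSet he
      induction e with
      | h x y =>
        refine hcases x y ?_ ?_ hmem
        · rintro rfl; exact hv (c.fst_mem_support_of_mem_edges he)
        · rintro rfl; exact hv (c.snd_mem_support_of_mem_edges he)
  · intro s hs
    by_cases hv : v ∈ s
    · classical
      have : s ⊆ {v, a, b} := by
        intro w hw
        by_cases hwv : w = v
        · simp [hwv]
        · have := hN' w (hs hv hw (Ne.symm hwv))
          grind
      exact (Finset.card_le_card this).trans Finset.card_le_three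
    · refine h.card_le s fun x hx y hy hxy ↦ hcases x y ?_ ?_ (hs hx hy hxy)
      · rintro rfl; exact hv hx
      · rintro rfl; exact hv hy

section Finite

variable [Finite α]

theorem ncard_edgeSet_eliminate_lt {v a b : α} (hva : G.Adj v a) (hvb : G.Adj v b) :
    (G.eliminate v a b).edgeSet.ncard < G.edgeSet.ncard := by
  by_cases hab : a = b
  · subst hab
    refine Set.ncard_lt_ncard ?_
    rw [edgeSet_ssubset_edgeSet]
    refine lt_of_le_of_ne (fun x y hxy ↦ ?_) fun he ↦ ?_
    · rw [eliminate_adj] at hxy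
      grind
    · rw [← he, eliminate_adj] at hva
      grind
  · have hsub : (G.eliminate v a b).edgeSet ⊆
        insert s(a, b) (G.edgeSet \ {s(v, a), s(v, b)}) := by
      intro e
      induction e with
      | h x y =>
        simp only [mem_edgeSet, eliminate_adj, Set.mem_insert_iff, Set.mem_sdiff,
          Set.mem_singleton_iff, Sym2.eq_iff]
        grind
    have h1 := Set.ncard_le_ncard hsub
    have h2 := Set.ncard_insert_le s(a, b) (G.edgeSet \ {s(v, a), s(v, b)})
    have h3 : ({s(v, a), s(v, b)} : Set (Sym2 α)) ⊆ G.edgeSet := by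
      rintro e (rfl | rfl)
      exacts [hva, hvb]
    have h4 : ({s(v, a), s(v, b)} : Set (Sym2 α)).ncard = 2 :=
      Set.ncard_pair (by grind [Sym2.eq_iff])
    have h5 := Set.ncard_sdiff_add_ncard_of_subset h3
    lia

theorem ncard_neighborSet_eliminate_le_two (hG : ∀ x, (G.neighborSet x).ncard ≤ 2) {v a b : α}
    (hva : G.Adj v a) (hvb : G.Adj v b) (x : α) :
    ((G.eliminate v a b).neighborSet x).ncard ≤ 2 := by
  have hav := hva.ne'
  have hbv := hvb.ne'
  have key : ∀ y z, G.Adj v y →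
      (G.eliminate v a b).neighborSet y ⊆ insert z (G.neighborSet y \ {v}) →
      ((G.eliminate v a b).neighborSet y).ncard ≤ 2 := by
    intro y z hvy hsub
    have h1 := Set.ncard_le_ncard hsub
    have h2 := Set.ncard_insert_le z (G.neighborSet y \ {v})
    have h3 := Set.ncard_sdiff_singleton_lt_of_mem (s := G.neighborSet y) (a := v) hvy.symm
    have h4 := hG y
    lia
  by_cases hxa : x = a
  · refine key x b (hxa ▸ hva) fun y hy ↦ ?_
    simp only [mem_neighborSet, eliminate_adj, Set.mem_insert_iff, Set.mem_sdiff,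
      Set.mem_singleton_iff] at hy ⊢
    grind
  by_cases hxb : x = b
  · refine key x a (hxb ▸ hvb) fun y hy ↦ ?_
    simp only [mem_neighborSet, eliminate_adj, Set.mem_insert_iff, Set.mem_sdiff,
      Set.mem_singleton_iff] at hy ⊢
    grind
  refine (Set.ncard_le_ncard fun y hy ↦ ?_).trans (hG x)
  rw [mem_neighborSet, eliminate_adj] at hy
  rw [mem_neighborSet]
  grind

theorem exists_isComponentwiseTriangulation (G : SimpleGraph α)
    (hG : ∀ v, (G.neighborSet v).ncard ≤ 2 ∨
      ((G.neighborSet v).ncard ≤ 3 ∧ ∃ w, G.Adj v w ∧ G.IsBridge s(v, w))) :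
    ∃ G', IsComponentwiseTriangulation G G' := by
  induction hn : G.edgeSet.ncard using Nat.strong_induction_on generalizing G with
  | _ n ih =>
  subst hn
  by_cases hbr : ∃ u v, G.Adj u v ∧ G.IsBridge s(u, v)
  · obtain ⟨u, v, huv, hbr⟩ := hbr
    have hlt : (G.deleteEdges {s(u, v)}).edgeSet.ncard < G.edgeSet.ncard := by
      rw [edgeSet_deleteEdges]
      exact Set.ncard_sdiff_singleton_lt_of_mem huv
    refine Exists.elim (ih _ hlt _ (fun x ↦ ?_) rfl) fun G' hG' ↦ ⟨_, hG'.sup_bridge huv hbr⟩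
    have hsub : (G.deleteEdges {s(u, v)}).neighborSet x ⊆ G.neighborSet x :=
      fun y hy ↦ deleteEdges_le _ hy
    have hle := Set.ncard_le_ncard hsub
    rcases hG x with h2 | ⟨h3, w, hxw, hb⟩
    · exact Or.inl (hle.trans h2)
    by_cases he : s(x, w) = s(u, v)
    · left
      have : (G.deleteEdges {s(u, v)}).neighborSet x ⊆ G.neighborSet x \ {w} := by
        refine fun y hy ↦ ⟨hsub hy, ?_⟩
        rintro rfl
        exact (deleteEdges_adj.1 hy).2 he
      have h4 := Set.ncard_le_ncard this
      have h5 := Set.ncard_sdiff_singleton_lt_of_mem (s := G.neighborSet x) (a := w) hxw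
      lia
    · exact Or.inr ⟨hle.trans h3, w, deleteEdges_adj.2 ⟨hxw, he⟩, hb.anti (deleteEdges_le _)⟩
  · have hdeg : ∀ x, (G.neighborSet x).ncard ≤ 2 := fun x ↦
      (hG x).resolve_right fun ⟨_, w, h⟩ ↦ hbr ⟨x, w, h⟩
    by_cases hadj : ∃ v a, G.Adj v a
    · obtain ⟨v, a, hva⟩ := hadj
      obtain ⟨b, hvb, hN⟩ : ∃ b, G.Adj v b ∧ ∀ w, G.Adj v w → w = a ∨ w = b := by
        by_cases hb : ∃ b, G.Adj v b ∧ b ≠ a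
        · obtain ⟨b, hvb, hba⟩ := hb
          refine ⟨b, hvb, fun w hw ↦ ?_⟩
          have hsub : ({a, b} : Set α) ⊆ G.neighborSet v := by
            rintro x (rfl | rfl)
            exacts [hva, hvb]
          have heq := Set.eq_of_subset_of_ncard_le hsub
            ((hdeg v).trans (Set.ncard_pair hba.symm).ge)
          have : w ∈ ({a, b} : Set α) := heq ▸ hw
          simpa using this
        · push Not at hb
          exact ⟨a, hva, fun w hw ↦ Or.inl (hb w hw)⟩
      obtain ⟨G', hG'⟩ := ih _ (ncard_edgeSet_eliminate_lt hva hvb) _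
        (fun x ↦ Or.inl (ncard_neighborSet_eliminate_le_two hdeg hva hvb x)) rfl
      exact ⟨_, hG'.sup_of_eliminate hva hvb hN⟩
    · push Not at hadj
      refine ⟨G, le_rfl, fun x y h ↦ h.reachable, fun u c hc ↦ ?_, fun s hs ↦ ?_⟩
      · exact absurd (c.adj_snd hc.not_nil) (hadj _ _)
      · refine le_trans (Finset.card_le_one.2 fun x hx y hy ↦ ?_) (by norm_num : 1 ≤ 3)
        by_contra hxy
        exact hadj _ _ (hs hx hy hxy)

end Finite

end SimpleGraph

/-- Let `G` be a simple connected graph in which every vertex has degree at most `3` and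
every vertex of degree exactly `3` is a cut vertex.  Then `G` has a triangulation (a
chordal supergraph on the same vertex set) whose clique number is at most `3`; in
particular the treewidth of `G` is at most `2`. -/
theorem stmt6 {α : Type*} [Fintype α] [DecidableEq α]
    (G : SimpleGraph α) [DecidableRel G.Adj]
    (hconn : G.Connected)
    (hdeg : ∀ v, G.degree v ≤ 3)
    (hcut : ∀ v, G.degree v = 3 → IsCutVertex G v) :
    ∃ G' : SimpleGraph α, G ≤ G' ∧ Chordal G' ∧
      ∀ s : Finset α, G'.IsClique (s : Set α) → s.card ≤ 3 := by
  have hcard : ∀ v, (G.neighborSet v).ncard = G.degree v := fun v ↦ by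
    rw [Set.ncard_eq_toFinset_card', Set.toFinset_card, G.card_neighborSet_eq_degree]
  obtain ⟨G', h⟩ := G.exists_isComponentwiseTriangulation fun v ↦ by
    rw [hcard]
    by_cases h3 : G.degree v = 3
    · obtain ⟨a, b, c, -, -, -, habc⟩ :=
        Finset.card_eq_three.1 ((G.card_neighborFinset_eq_degree v).trans h3)
      refine Or.inr ⟨hdeg v, SimpleGraph.exists_isBridge_of_isCutVertex (a := a) (b := b) (c := c)
        hconn (fun w ↦ ?_) (hcut v h3)⟩
      rw [← SimpleGraph.mem_neighborFinset, habc]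
      simp
    · have := hdeg v
      left
      lia
  exact ⟨G', h.le, h.chordal, h.card_le⟩
end

section
/- Let G = (V,E) be a simple connected undirected graph in which every vertex has degree at most 3 and every vertex of degree exactly 3 is a cut vertex. Then any two cycles in G with different edge sets are non-overlapping: if C₁ and C₂ are cycles in G whose edge sets are not equal, then C₁ and C₂ have no vertex in common (and hence no edge in common). -/
namespace SimpleGraph

variable {α : Type*} {G : SimpleGraph α}

theorem Walk.IsCycle.reachable_induce_compl_singleton [DecidableEq α] {a v p q : α}
    {c : G.Walk a a} (hc : c.IsCycle) (hv : v ∈ c.support) (hp : p ∈ c.support)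
    (hq : q ∈ c.support) (hpv : p ∈ ({v}ᶜ : Set α)) (hqv : q ∈ ({v}ᶜ : Set α)) :
    (G.induce ({v}ᶜ : Set α)).Reachable ⟨p, hpv⟩ ⟨q, hqv⟩ := by
  obtain ⟨c', hc', hsupp⟩ : ∃ c' : G.Walk v v, c'.IsCycle ∧
      ∀ x, x ∈ c'.support ↔ x ∈ c.support :=
    ⟨c.rotate v hv, hc.rotate hv, fun x => Walk.mem_support_rotate_iff ..⟩
  rw [← hsupp] at hp hq
  cases c' with
  | nil => exact absurd rfl hc'.ne_nil
  | @cons _ w _ h r =>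
    have hr : r.IsPath := ((Walk.cons_isCycle_iff r h).1 hc').1
    have hwv : w ∈ ({v}ᶜ : Set α) := h.ne'
    have reach (u : α) (hu : u ∈ (Walk.cons h r).support) (huv : u ∈ ({v}ᶜ : Set α)) :
        (G.induce ({v}ᶜ : Set α)).Reachable ⟨w, hwv⟩ ⟨u, huv⟩ := by
      have hur : u ∈ r.support := by
        rw [Walk.support_cons, List.mem_cons] at hu
        exact hu.resolve_left huv
      have hnot := Walk.endpoint_notMem_support_takeUntil hr hur (Ne.symm huv)
      exact ((r.takeUntil u hur).induce ({v}ᶜ : Set α)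
        (fun x hx hxv => hnot (hxv ▸ hx))).reachable
    exact (reach p hp hpv).symm.trans (reach q hq hqv)

theorem Connected.induce_compl_singleton_of_neighbors_reachable (hG : G.Connected) {v p : α}
    (hpv : p ∈ ({v}ᶜ : Set α))
    (h : ∀ q (hq : G.Adj v q), (G.induce ({v}ᶜ : Set α)).Reachable ⟨p, hpv⟩ ⟨q, hq.ne'⟩) :
    (G.induce ({v}ᶜ : Set α)).Connected := by
  rw [connected_iff_exists_forall_reachable]
  refine ⟨⟨p, hpv⟩, fun ⟨u, hu⟩ => ?_⟩
  obtain ⟨r, hr⟩ := (hG v u).exists_isPath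
  cases r with
  | nil => exact absurd rfl hu
  | @cons _ w _ hw r =>
    have hnot := ((Walk.cons_isPath_iff hw r).1 hr).2
    exact (h w hw).trans (r.induce ({v}ᶜ : Set α) (fun x hx hxv => hnot (hxv ▸ hx))).reachable

/-- Two cycles through a vertex which either has degree at most two, or is a cut vertex of
degree three, use the same edges at that vertex. -/
theorem Walk.IsCycle.neighborSet_toSubgraph_eq [Fintype α] [DecidableEq α] [DecidableRel G.Adj]
    (hG : G.Connected) {a b v : α} {c₁ : G.Walk a a} {c₂ : G.Walk b b}
    (h₁ : c₁.IsCycle) (h₂ : c₂.IsCycle) (hv₁ : v ∈ c₁.support) (hv₂ : v ∈ c₂.support)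
    (hdeg : G.degree v ≤ 3) (hcut : G.degree v = 3 → IsCutVertex G v) :
    c₁.toSubgraph.neighborSet v = c₂.toSubgraph.neighborSet v := by
  set A := c₁.toSubgraph.neighborSet v with hA
  set B := c₂.toSubgraph.neighborSet v with hB
  have hAc : A.ncard = 2 := h₁.ncard_neighborSet_toSubgraph_eq_two hv₁
  have hBc : B.ncard = 2 := h₂.ncard_neighborSet_toSubgraph_eq_two hv₂
  have hAB : A ∪ B ⊆ G.neighborSet v :=
    Set.union_subset (c₁.toSubgraph.neighborSet_subset v) (c₂.toSubgraph.neighborSet_subset v)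
  have hN : (G.neighborSet v).ncard = G.degree v := by
    rw [Set.ncard_eq_toFinset_card', ← G.card_neighborFinset_eq_degree]; rfl
  have hsum := Set.ncard_union_add_ncard_inter A B
  have hle := Set.ncard_le_ncard hAB
  by_contra hne
  have hinter : (A ∩ B).ncard < 2 := by
    by_contra! hge
    have e₁ : A ∩ B = A := Set.eq_of_subset_of_ncard_le Set.inter_subset_left (by omega)
    have e₂ : A ∩ B = B := Set.eq_of_subset_of_ncard_le Set.inter_subset_right (by omega)
    exact hne (e₁.symm.trans e₂)
  have hunion : A ∪ B = G.neighborSet v := Set.eq_of_subset_of_ncard_le hAB (by omega)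
  obtain ⟨p, hpA, hpB⟩ : (A ∩ B).Nonempty := by
    rw [← Set.ncard_pos]; omega
  have mem₁ {x : α} (hx : x ∈ A) : x ∈ c₁.support :=
    c₁.mem_verts_toSubgraph.1 (c₁.toSubgraph.edge_vert (c₁.toSubgraph.adj_symm hx))
  have mem₂ {x : α} (hx : x ∈ B) : x ∈ c₂.support :=
    c₂.mem_verts_toSubgraph.1 (c₂.toSubgraph.edge_vert (c₂.toSubgraph.adj_symm hx))
  have hpv : p ∈ ({v}ᶜ : Set α) := (c₁.toSubgraph.adj_sub hpA).ne'
  refine hcut (by omega) (hG.induce_compl_singleton_of_neighbors_reachable hpv fun q hq => ?_)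
  have hq' : q ∈ A ∪ B := hunion ▸ hq
  rcases hq' with hqA | hqB
  · exact h₁.reachable_induce_compl_singleton hv₁ (mem₁ hpA) (mem₁ hqA) hpv hq.ne'
  · exact h₂.reachable_induce_compl_singleton hv₂ (mem₂ hpB) (mem₂ hqB) hpv hq.ne'

theorem Walk.mem_of_mem_support {a x y : α} {c : G.Walk a y} {S : Set α} (hx : x ∈ c.support)
    (hxS : x ∈ S) (hS : ∀ u w, c.toSubgraph.Adj u w → u ∈ S → w ∈ S) {z : α}
    (hz : z ∈ c.support) : z ∈ S := by
  have hreach := c.toSubgraph_connected.coe.preconnected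
    ⟨x, c.mem_verts_toSubgraph.2 hx⟩ ⟨z, c.mem_verts_toSubgraph.2 hz⟩
  rw [reachable_iff_reflTransGen] at hreach
  have key : ∀ t : c.toSubgraph.verts,
      Relation.ReflTransGen c.toSubgraph.coe.Adj ⟨x, c.mem_verts_toSubgraph.2 hx⟩ t →
        (t : α) ∈ S := by
    intro t ht
    induction ht with
    | refl => exact hxS
    | tail _ hadj ih => exact hS _ _ hadj ih
  exact key _ hreach

theorem Walk.edges_subset_of_neighborSet_toSubgraph_eq {a b a' b' x : α} {c₁ : G.Walk a a'}
    {c₂ : G.Walk b b'} (hx₁ : x ∈ c₁.support) (hx₂ : x ∈ c₂.support)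
    (h : ∀ v ∈ c₁.support, v ∈ c₂.support →
      c₁.toSubgraph.neighborSet v = c₂.toSubgraph.neighborSet v) :
    c₁.edges ⊆ c₂.edges := by
  have adj {u w : α} (huw : c₁.toSubgraph.Adj u w) (hu : u ∈ c₂.support) :
      c₂.toSubgraph.Adj u w := by
    have hw : w ∈ c₁.toSubgraph.neighborSet u := huw
    rwa [h u (c₁.mem_verts_toSubgraph.1 (c₁.toSubgraph.edge_vert huw)) hu] at hw
  intro e he
  induction e using Sym2.ind with
  | _ u w =>
    rw [← Walk.mem_edges_toSubgraph, Subgraph.mem_edgeSet] at he ⊢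
    refine adj he (Walk.mem_of_mem_support (S := {z | z ∈ c₂.support}) hx₁ hx₂
      (fun u w huw hu => ?_) (c₁.mem_verts_toSubgraph.1 (c₁.toSubgraph.edge_vert he)))
    exact c₂.mem_verts_toSubgraph.1
      (c₂.toSubgraph.edge_vert (c₂.toSubgraph.adj_symm (adj huw hu)))

end SimpleGraph

/-- Let `G` be a simple connected graph in which every vertex has degree at most `3` and
every vertex of degree exactly `3` is a cut vertex.  Then any two cycles of `G` whose
edge sets differ are non-overlapping: they have no vertex in common (hence no edge in
common). -/
theorem stmt7 {α : Type*} [Fintype α] [DecidableEq α]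
    (G : SimpleGraph α) [DecidableRel G.Adj]
    (hconn : G.Connected)
    (hdeg : ∀ v, G.degree v ≤ 3)
    (hcut : ∀ v, G.degree v = 3 → IsCutVertex G v)
    {a b : α} (c₁ : G.Walk a a) (c₂ : G.Walk b b)
    (h₁ : c₁.IsCycle) (h₂ : c₂.IsCycle)
    (hne : c₁.edges.toFinset ≠ c₂.edges.toFinset) :
    ∀ x, x ∈ c₁.support → x ∉ c₂.support := by
  intro x hx₁ hx₂
  have h (v : α) (hv₁ : v ∈ c₁.support) (hv₂ : v ∈ c₂.support) :=
    h₁.neighborSet_toSubgraph_eq hconn h₂ hv₁ hv₂ (hdeg v) (hcut v)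
  have hsub₁ := SimpleGraph.Walk.edges_subset_of_neighborSet_toSubgraph_eq hx₁ hx₂ h
  have hsub₂ := SimpleGraph.Walk.edges_subset_of_neighborSet_toSubgraph_eq hx₂ hx₁
    fun v hv₂ hv₁ => (h v hv₁ hv₂).symm
  refine hne (Finset.ext fun e => ?_)
  rw [List.mem_toFinset, List.mem_toFinset]
  exact ⟨fun he => hsub₁ he, fun he => hsub₂ he⟩
end

section
/- Let G = (V,E) be a simple connected undirected graph in which every vertex has degree at most 3. If there is a vertex of degree exactly 3 which is not a cut vertex, then there are at least two distinct vertices of degree exactly 3 which are not cut vertices. -/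
namespace SimpleGraph

variable {V : Type*} {G : SimpleGraph V}

/-- The spanning subgraph of `G` whose edges are the non-bridge edges of `G`. -/
def deleteBridges (G : SimpleGraph V) : SimpleGraph V where
  Adj a b := G.Adj a b ∧ ¬ G.IsBridge s(a, b)
  symm := ⟨fun a b h => ⟨h.1.symm, by rw [Sym2.eq_swap]; exact h.2⟩⟩
  loopless := ⟨fun a h => G.loopless.irrefl a h.1⟩

theorem deleteBridges_adj {a b : V} :
    G.deleteBridges.Adj a b ↔ G.Adj a b ∧ ¬ G.IsBridge s(a, b) := Iff.rfl

theorem deleteBridges_le : G.deleteBridges ≤ G := fun _ _ h => h.1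

theorem Reachable.mem_of_closed {S : Set V} (hS : ∀ a ∈ S, ∀ b, G.Adj a b → b ∈ S) {a b : V}
    (h : G.Reachable a b) (ha : a ∈ S) : b ∈ S := by
  obtain ⟨p⟩ := h
  induction p with
  | nil => exact ha
  | cons hadj _ ih => exact ih (hS _ ha _ hadj)

/-- A non-bridge edge lies on a cycle, so each endpoint has a second non-bridge edge. -/
theorem deleteBridges_exists_ne_adj {w x : V} (h : G.deleteBridges.Adj w x) :
    ∃ y, y ≠ x ∧ G.deleteBridges.Adj w y := by
  obtain ⟨hadj, hb⟩ := h
  rw [isBridge_iff_forall_cycle_notMem hadj] at hb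
  push Not at hb
  obtain ⟨u, p, hp, he⟩ := hb
  have h2 := hp.ncard_neighborSet_toSubgraph_eq_two (p.fst_mem_support_of_mem_edges he)
  obtain ⟨y, hy, hyx⟩ := Set.exists_ne_of_one_lt_ncard (h2 ▸ Nat.one_lt_two) x
  have hy' : s(w, y) ∈ p.edges := Walk.adj_toSubgraph_iff_mem_edges.mp hy
  exact ⟨y, hyx, p.edges_subset_edgeSet hy', fun hbr => hbr.notMem_edges_of_isCycle hp hy'⟩

/-- The edges at a vertex of degree at least two whose removal leaves `G` connected
are not bridges. -/
theorem not_isBridge_of_connected_induce_compl {v a b : V}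
    (hv : (G.induce ({v}ᶜ : Set V)).Connected) (ha : G.Adj v a) (hb : G.Adj v b) (hab : a ≠ b) :
    ¬ G.IsBridge s(v, a) := by
  rw [isBridge_iff, not_not]
  have hr := hv.preconnected ⟨b, hb.ne'⟩ ⟨a, ha.ne'⟩
  let f : G.induce ({v}ᶜ : Set V) →g G.deleteEdges {s(v, a)} :=
    ⟨Subtype.val, by
      rintro ⟨c, hc⟩ ⟨d, hd⟩ hcd
      simp only [Set.mem_compl_iff, Set.mem_singleton_iff] at hc hd
      simp only [comap_adj, Function.Embedding.subtype_apply] at hcd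
      simp [deleteEdges_adj, hcd, hc, hd]⟩
  have hvb : (G.deleteEdges {s(v, a)}).Adj v b := by
    simp [deleteEdges_adj, hb, hab.symm, hb.ne']
  exact hvb.reachable.trans (hr.map f)

theorem exists_reachable_induce_compl_of_adj (hG : G.Preconnected) {w : V}
    (x : ({w}ᶜ : Set V)) :
    ∃ y : ({w}ᶜ : Set V), G.Adj w y ∧ (G.induce ({w}ᶜ : Set V)).Reachable x y := by
  by_contra! hcon
  let S : Set V := {z | ∃ hz : z ∈ ({w}ᶜ : Set V), (G.induce ({w}ᶜ : Set V)).Reachable x ⟨z, hz⟩}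
  have hw : w ∈ S := by
    refine (hG x w).mem_of_closed ?_ ⟨x.2, .rfl⟩
    rintro a ⟨ha, hxa⟩ b hab
    have hb : b ≠ w := by
      rintro rfl
      exact hcon ⟨a, ha⟩ hab.symm hxa
    exact ⟨hb, hxa.trans (Adj.reachable (G := G.induce ({w}ᶜ : Set V)) hab)⟩
  exact hw.1 rfl

theorem exists_ne_reachable_induce_compl {w : V} (x : ({w}ᶜ : Set V))
    (hx : ¬ G.IsBridge s(w, (x : V))) :
    ∃ y : ({w}ᶜ : Set V), y ≠ x ∧ G.Adj w y ∧ (G.induce ({w}ᶜ : Set V)).Reachable x y := by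
  by_contra! hcon
  rw [isBridge_iff, not_not] at hx
  let S : Set V := {z | ∃ hz : z ∈ ({w}ᶜ : Set V), (G.induce ({w}ᶜ : Set V)).Reachable x ⟨z, hz⟩}
  have hw : w ∈ S := by
    refine hx.symm.mem_of_closed ?_ ⟨x.2, .rfl⟩
    rintro a ⟨ha, hxa⟩ b hab
    rw [deleteEdges_adj] at hab
    have hb : b ≠ w := by
      rintro rfl
      refine hcon ⟨a, ha⟩ ?_ hab.1.symm hxa
      rintro rfl
      exact hab.2 (by simp [Sym2.eq_swap])
    exact ⟨hb, hxa.trans (Adj.reachable (G := G.induce ({w}ᶜ : Set V)) hab.1)⟩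
  exact hw.1 rfl

/-- Deleting a degree-three vertex that is incident to no bridge leaves `G` connected. -/
theorem connected_induce_compl_of_degree_eq_three (hG : G.Preconnected) {w : V}
    [Fintype (G.neighborSet w)] (hw : G.degree w = 3)
    (hb : ∀ x, G.Adj w x → ¬ G.IsBridge s(w, x)) :
    (G.induce ({w}ᶜ : Set V)).Connected := by
  classical
  obtain ⟨a, b, c, -, -, -, hN⟩ := Finset.card_eq_three.mp hw
  have hmem : ∀ x, G.Adj w x ↔ x = a ∨ x = b ∨ x = c := fun x => by
    rw [← mem_neighborFinset, hN]; simp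
  have ha : G.Adj w a := by simp [hmem]
  have hb' : G.Adj w b := by simp [hmem]
  have hc : G.Adj w c := by simp [hmem]
  let A : ({w}ᶜ : Set V) := ⟨a, ha.ne'⟩
  let B : ({w}ᶜ : Set V) := ⟨b, hb'.ne'⟩
  let C : ({w}ᶜ : Set V) := ⟨c, hc.ne'⟩
  have hmem' : ∀ x : ({w}ᶜ : Set V), G.Adj w x → x = A ∨ x = B ∨ x = C := fun x hx => by
    simpa [A, B, C, Subtype.ext_iff] using (hmem x).mp hx
  have key : ∀ x : ({w}ᶜ : Set V), G.Adj w x → ∃ y, y ≠ x ∧ (y = A ∨ y = B ∨ y = C) ∧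
      (G.induce ({w}ᶜ : Set V)).Reachable x y := fun x hx => by
    obtain ⟨y, hyx, hy, hr⟩ := exists_ne_reachable_induce_compl x (hb x hx)
    exact ⟨y, hyx, hmem' y hy, hr⟩
  have hall : (G.induce ({w}ᶜ : Set V)).Reachable A B ∧
      (G.induce ({w}ᶜ : Set V)).Reachable A C := by
    obtain ⟨x, hx, hx', hxr⟩ := key A ha
    obtain ⟨y, hy, hy', hyr⟩ := key B hb'
    obtain ⟨z, hz, hz', hzr⟩ := key C hc
    rcases hx' with rfl | rfl | rfl
    · exact absurd rfl hx
    · rcases hz' with rfl | rfl | rfl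
      · exact ⟨hxr, hzr.symm⟩
      · exact ⟨hxr, hxr.trans hzr.symm⟩
      · exact absurd rfl hz
    · rcases hy' with rfl | rfl | rfl
      · exact ⟨hyr.symm, hxr⟩
      · exact absurd rfl hy
      · exact ⟨hxr.trans hyr.symm, hxr⟩
  have hA : ∀ x, (G.induce ({w}ᶜ : Set V)).Reachable x A := fun x => by
    obtain ⟨y, hy, hr⟩ := exists_reachable_induce_compl_of_adj hG x
    rcases hmem' y hy with rfl | rfl | rfl
    · exact hr
    · exact hr.trans hall.1.symm
    · exact hr.trans hall.2.symm
  exact (connected_iff _).mpr ⟨fun x y => (hA x).trans (hA y).symm, ⟨A⟩⟩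

end SimpleGraph

/-- Let `G` be a simple connected graph in which every vertex has degree at most `3`.
If some vertex of degree exactly `3` is not a cut vertex, then there are at least two
distinct vertices of degree exactly `3` which are not cut vertices. -/
theorem stmt8 {α : Type*} [Fintype α] [DecidableEq α]
    (G : SimpleGraph α) [DecidableRel G.Adj]
    (hconn : G.Connected)
    (hdeg : ∀ v, G.degree v ≤ 3)
    (hex : ∃ v, G.degree v = 3 ∧ ¬ IsCutVertex G v) :
    ∃ v w, v ≠ w ∧
      G.degree v = 3 ∧ ¬ IsCutVertex G v ∧
      G.degree w = 3 ∧ ¬ IsCutVertex G w := by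
  classical
  obtain ⟨v, hv3, hv⟩ := hex
  have hvc := not_not.mp hv
  have hdv : G.deleteBridges.degree v = 3 := by
    rw [← hv3, ← SimpleGraph.card_neighborFinset_eq_degree,
      ← SimpleGraph.card_neighborFinset_eq_degree]
    congr 1
    ext a
    simp only [SimpleGraph.mem_neighborFinset, SimpleGraph.deleteBridges_adj, and_iff_left_iff_imp]
    intro ha
    obtain ⟨b, hb, hba⟩ := Finset.exists_mem_ne
      (by rw [SimpleGraph.card_neighborFinset_eq_degree, hv3]; norm_num :
        1 < (G.neighborFinset v).card) a
    exact SimpleGraph.not_isBridge_of_connected_induce_compl hvc ha (by simpa using hb) hba.symm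
  obtain ⟨w, hwv, hodd⟩ := G.deleteBridges.exists_ne_odd_degree_of_exists_odd_degree v
    (by rw [hdv]; decide)
  have hle : G.deleteBridges.degree w ≤ G.degree w :=
    SimpleGraph.degree_le_of_le SimpleGraph.deleteBridges_le
  have hne1 : G.deleteBridges.degree w ≠ 1 := fun h1 => by
    obtain ⟨x, hx⟩ := Finset.card_eq_one.mp h1
    have hmem : ∀ y, G.deleteBridges.Adj w y ↔ y = x := fun y => by
      rw [← SimpleGraph.mem_neighborFinset, hx, Finset.mem_singleton]
    obtain ⟨y, hyx, hy⟩ := SimpleGraph.deleteBridges_exists_ne_adj ((hmem x).mpr rfl)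
    exact hyx ((hmem y).mp hy)
  have h3 := hdeg w
  have hw : G.deleteBridges.degree w = 3 := by
    obtain ⟨k, hk⟩ := hodd
    omega
  have hw3 : G.degree w = 3 := by omega
  refine ⟨v, w, hwv.symm, hv3, hv, hw3, not_not.mpr ?_⟩
  refine SimpleGraph.connected_induce_compl_of_degree_eq_three hconn.preconnected hw3 ?_
  have hN : G.deleteBridges.neighborFinset w = G.neighborFinset w :=
    Finset.eq_of_subset_of_card_le
      (fun x hx => by
        rw [SimpleGraph.mem_neighborFinset] at hx ⊢
        exact hx.1)
      (by rw [SimpleGraph.card_neighborFinset_eq_degree,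
        SimpleGraph.card_neighborFinset_eq_degree, hw, hw3])
  intro x hx
  rw [← SimpleGraph.mem_neighborFinset, ← hN, SimpleGraph.mem_neighborFinset] at hx
  exact hx.2
end

section
/- Let G = (V,E) be a simple connected undirected graph with |V| = n in which every vertex has degree at most 3, and suppose there is a vertex of degree exactly 3 which is not a cut vertex. Then for every bijection φ : V → {1,…,n}, the maximum edge-boundary degree over the non-singleton clusters of the linear reassembling determined by φ is at least 3: max_{2≤j≤n} deg(L(φ,j)) ≥ 3. -/
open Finset

/-- The edge-boundary degree of a vertex set `A` in a simple graph `G`: the number of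
edges of `G` with exactly one endpoint in `A`. -/
def cutDeg {α : Type*} [Fintype α] [DecidableEq α] (G : SimpleGraph α) [DecidableRel G.Adj]
    (A : Finset α) : ℕ :=
  (univ.filter (fun e : α × α => e.1 ∈ A ∧ e.2 ∉ A ∧ G.Adj e.1 e.2)).card

/-- `L(φ, j)`: the set of vertices occupying the first `j` positions of the linear
arrangement `φ` (positions `1, …, n` of the paper correspond to values `0, …, n-1` of
`φ`). -/
def prefixSet {α : Type*} [Fintype α] {N : ℕ} (φ : α ≃ Fin N) (j : ℕ) : Finset α :=
  univ.filter (fun v => (φ v : ℕ) < j)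

/-- If `v` is not a cut vertex, any nontrivial bipartition of the other vertices is crossed
by an edge. -/
theorem exists_adj_of_not_isCutVertex {α : Type*} {G : SimpleGraph α} {v : α}
    (hv : ¬ IsCutVertex G v) {A : Set α} (hvA : v ∉ A) {x y : α} (hx : x ∈ A) (hy : y ∉ A)
    (hyv : y ≠ v) : ∃ a b, a ∈ A ∧ b ∉ A ∧ b ≠ v ∧ G.Adj a b := by
  have hc : (SimpleGraph.induce ({v}ᶜ : Set α) G).Connected := not_not.mp hv
  have hxv : x ≠ v := fun h => hvA (h ▸ hx)
  obtain ⟨p⟩ := hc.preconnected ⟨x, hxv⟩ ⟨y, hyv⟩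
  obtain ⟨d, -, hd₁, hd₂⟩ := p.exists_boundary_dart (Subtype.val ⁻¹' A) hx hy
  exact ⟨d.fst, d.snd, hd₁, hd₂, d.snd.2, d.adj⟩

section

variable {α : Type*} [Fintype α] [DecidableEq α] {G : SimpleGraph α} [DecidableRel G.Adj]
  {v : α} {A : Finset α}

theorem card_neighborFinset_inter_le_cutDeg (hvA : v ∉ A) :
    (G.neighborFinset v ∩ A).card ≤ cutDeg G A := by
  refine card_le_card_of_injOn (fun w => (w, v)) (fun w hw => ?_) (fun _ _ _ _ h => ?_)
  · simp only [coe_inter, Set.mem_inter_iff, mem_coe, SimpleGraph.mem_neighborFinset] at hw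
    simp [hw.2, hvA, hw.1.symm]
  · exact congrArg Prod.fst h

theorem card_neighborFinset_inter_lt_cutDeg (hv : ¬ IsCutVertex G v) (hvA : v ∉ A) {x y : α}
    (hx : x ∈ A) (hy : y ∉ A) (hyv : y ≠ v) :
    (G.neighborFinset v ∩ A).card < cutDeg G A := by
  obtain ⟨a, b, ha, hb, hbv, hab⟩ :=
    exists_adj_of_not_isCutVertex hv (A := (A : Set α)) hvA hx hy hyv
  rw [← card_image_of_injective (f := fun w => (w, v)) _ (fun _ _ h => congrArg Prod.fst h)]
  refine card_lt_card ((ssubset_iff_of_subset fun e he => ?_).2 ⟨(a, b), ?_, ?_⟩)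
  · obtain ⟨w, hw, rfl⟩ := mem_image.mp he
    simp only [mem_inter, SimpleGraph.mem_neighborFinset] at hw
    simp [hw.2, hvA, hw.1.symm]
  · simpa using ⟨ha, hb, hab⟩
  · simp [hbv.symm]

theorem card_neighborFinset_sdiff_lt_cutDeg (hv : ¬ IsCutVertex G v) (hvA : v ∉ A) {x y : α}
    (hx : x ∈ A) (hy : y ∉ A) (hyv : y ≠ v) :
    (G.neighborFinset v \ A).card < cutDeg G (insert v A) := by
  obtain ⟨a, b, ha, hb, hbv, hab⟩ :=
    exists_adj_of_not_isCutVertex hv (A := (A : Set α)) hvA hx hy hyv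
  rw [← card_image_of_injective (f := fun w => (v, w)) _ (fun _ _ h => congrArg Prod.snd h)]
  refine card_lt_card ((ssubset_iff_of_subset fun e he => ?_).2 ⟨(a, b), ?_, ?_⟩)
  · obtain ⟨w, hw, rfl⟩ := mem_image.mp he
    simp only [mem_sdiff, SimpleGraph.mem_neighborFinset] at hw
    simp [hw.2, hw.1, hw.1.ne']
  · have ha' : a ∈ A := ha
    have hb' : b ∉ A := hb
    simp [ha', hb', hbv, hab]
  · have hva : v ≠ a := fun h => hvA (h ▸ ha)
    simp [hva]

end

theorem card_prefixSet_le {α : Type*} [Fintype α] {N : ℕ} (φ : α ≃ Fin N) (j : ℕ) :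
    (prefixSet φ j).card ≤ j := by
  rw [← card_range j]
  refine card_le_card_of_injOn (fun v => (φ v : ℕ)) (fun v hv => ?_) (fun _ _ _ _ h => ?_)
  · simpa [prefixSet] using hv
  · exact φ.injective (Fin.ext h)

theorem prefixSet_succ {α : Type*} [Fintype α] [DecidableEq α] {N : ℕ} (φ : α ≃ Fin N) (v : α) :
    prefixSet φ (φ v + 1) = insert v (prefixSet φ (φ v)) := by
  ext w
  simp only [prefixSet, mem_filter, mem_univ, true_and, mem_insert, ← φ.injective.eq_iff,
    Fin.ext_iff]
  omega

/-- Let `G` be a simple connected graph with `n` vertices, all of degree `≤ 3`, having a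
vertex of degree exactly `3` that is not a cut vertex.  Then for every linear arrangement
`φ`, the maximum edge-boundary degree over the non-singleton clusters
`L(φ,2), …, L(φ,n)` of the linear reassembling determined by `φ` is at least `3`. -/
theorem stmt9 {α : Type*} [Fintype α] [DecidableEq α]
    (G : SimpleGraph α) [DecidableRel G.Adj]
    (hconn : G.Connected) (hdeg : ∀ v, G.degree v ≤ 3)
    (v₀ : α) (hv₀deg : G.degree v₀ = 3) (hv₀cut : ¬ IsCutVertex G v₀)
    (n : ℕ) (hn : Fintype.card α = n) (φ : α ≃ Fin n) :
    3 ≤ (Finset.Icc 2 n).sup (fun j => cutDeg G (prefixSet φ j)) := by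
  have le_sup_of_cut : ∀ j, 2 ≤ j → j ≤ n → 3 ≤ cutDeg G (prefixSet φ j) →
      3 ≤ (Finset.Icc 2 n).sup (fun j => cutDeg G (prefixSet φ j)) := fun j h2 hjn h =>
    h.trans (le_sup (f := fun j => cutDeg G (prefixSet φ j)) (mem_Icc.mpr ⟨h2, hjn⟩))
  have hlt : (φ v₀ : ℕ) < n := (φ v₀).isLt
  have hn4 : 4 ≤ n := by
    have := G.degree_lt_card_verts v₀
    omega
  have hsplit (A : Finset α) :
      (G.neighborFinset v₀ ∩ A).card + (G.neighborFinset v₀ \ A).card = 3 := by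
    rw [card_inter_add_card_sdiff, SimpleGraph.card_neighborFinset_eq_degree, hv₀deg]
  have mem_prefix (w : α) (j : ℕ) : w ∈ prefixSet φ j ↔ (φ w : ℕ) < j := by simp [prefixSet]
  have val_symm (i : ℕ) (hi : i < n) : (φ (φ.symm ⟨i, hi⟩) : ℕ) = i := by simp
  have ne_of_val {w : α} (h : (φ w : ℕ) ≠ φ v₀) : w ≠ v₀ := fun e => h (e ▸ rfl)
  rcases Nat.eq_zero_or_pos (φ v₀ : ℕ) with h0 | hpos
  · -- `v₀` comes first: compare with the set consisting of the second vertex only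
    set u := φ.symm ⟨1, by omega⟩
    have hu1 : (φ u : ℕ) = 1 := val_symm 1 _
    have hy2 : (φ (φ.symm ⟨2, by omega⟩) : ℕ) = 2 := val_symm 2 (by omega)
    have hcut := card_neighborFinset_sdiff_lt_cutDeg (A := {u}) (x := u)
      (y := φ.symm ⟨2, by omega⟩) hv₀cut
      (by rw [mem_singleton]; exact (ne_of_val (by omega)).symm) (mem_singleton_self u)
      (by rw [mem_singleton]; intro e; rw [e] at hy2; omega) (ne_of_val (by omega))
    have hpre : prefixSet φ 2 = insert v₀ {u} := by
      have hempty : prefixSet φ (φ v₀) = ∅ := by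
        ext w
        simp [mem_prefix, h0]
      have h1 := prefixSet_succ φ v₀
      have h2 := prefixSet_succ φ u
      rw [hempty, h0] at h1
      rw [hu1] at h2
      rw [h2, h1]
      exact pair_comm _ _
    have hle : (G.neighborFinset v₀ ∩ {u}).card ≤ 1 :=
      (card_le_card inter_subset_right).trans (card_singleton u).le
    have := hsplit {u}
    exact le_sup_of_cut 2 le_rfl (by omega) (by rw [hpre]; omega)
  · have hvA : v₀ ∉ prefixSet φ (φ v₀) := by simp [mem_prefix]
    have hs := hsplit (prefixSet φ (φ v₀))
    have hA : (G.neighborFinset v₀ ∩ prefixSet φ (φ v₀)).card ≤ φ v₀ :=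
      (card_le_card inter_subset_right).trans (card_prefixSet_le φ _)
    by_cases hlast : (φ v₀ : ℕ) + 1 = n
    · have hsub : G.neighborFinset v₀ \ prefixSet φ (φ v₀) = ∅ := by
        rw [sdiff_eq_empty_iff_subset]
        intro w hw
        have hne : (φ w : ℕ) ≠ φ v₀ := fun e =>
          ((SimpleGraph.mem_neighborFinset _ _ _).1 hw).ne' (φ.injective (Fin.ext e))
        have := (φ w).isLt
        rw [mem_prefix]
        omega
      rw [hsub, card_empty] at hs
      have := card_neighborFinset_inter_le_cutDeg (G := G) hvA
      exact le_sup_of_cut (φ v₀) (by omega) (by omega) (by omega)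
    · have hx := val_symm 0 (by omega)
      have hy := val_symm (φ v₀ + 1) (by omega)
      have hxA : φ.symm ⟨0, by omega⟩ ∈ prefixSet φ (φ v₀) := by rw [mem_prefix]; omega
      have hyA : φ.symm ⟨φ v₀ + 1, by omega⟩ ∉ prefixSet φ (φ v₀) := by rw [mem_prefix]; omega
      have hyv := ne_of_val (w := φ.symm ⟨φ v₀ + 1, by omega⟩) (by omega)
      have hbefore := card_neighborFinset_inter_lt_cutDeg hv₀cut hvA hxA hyA hyv
      have hafter := card_neighborFinset_sdiff_lt_cutDeg hv₀cut hvA hxA hyA hyv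
      rw [← prefixSet_succ] at hafter
      by_cases h2 : 2 ≤ (G.neighborFinset v₀ ∩ prefixSet φ (φ v₀)).card
      · exact le_sup_of_cut (φ v₀) (by omega) (by omega) (by omega)
      · exact le_sup_of_cut (φ v₀ + 1) (by omega) (by omega) (by omega)
end

section
/- Let G = (V,E) be a simple connected undirected graph with |V| = n in which every vertex has degree at most 3, and suppose there is a vertex of degree exactly 3 which is not a cut vertex. Let φ : V → {1,…,n} be a bijection with deg(φ⁻¹(1)) ≤ deg(φ⁻¹(2)). Then: (a) α_L(G,φ) = α_A(G,φ); and (b) α_L(G,φ) = min over all bijections ψ : V → {1,…,n} of α_L(G,ψ) if and only if α_A(G,φ) = min over all bijections ψ : V → {1,…,n} of α_A(G,ψ). -/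
open Finset

/-- The α-measure of the linear arrangement `φ`: `max_{1 ≤ i ≤ N} deg(L(φ,i))`. -/
def alphaA {α : Type*} [Fintype α] [DecidableEq α] (G : SimpleGraph α) [DecidableRel G.Adj]
    {N : ℕ} (φ : α ≃ Fin N) : ℕ :=
  (Finset.Icc 1 N).sup (fun i => cutDeg G (prefixSet φ i))

/-- The α-measure of the linear reassembling determined by `φ`: the maximum of all vertex
degrees (the singleton clusters) and of `deg(L(φ,j))` for `2 ≤ j ≤ N` (the non-singleton
clusters). -/
def alphaL {α : Type*} [Fintype α] [DecidableEq α] (G : SimpleGraph α) [DecidableRel G.Adj]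
    {N : ℕ} (φ : α ≃ Fin N) : ℕ :=
  max (univ.sup (fun v => G.degree v))
    ((Finset.Icc 2 N).sup (fun j => cutDeg G (prefixSet φ j)))

lemma degree_inter_le_cutDeg {α : Type*} [Fintype α] [DecidableEq α]
    (G : SimpleGraph α) [DecidableRel G.Adj] {v : α} {A : Finset α} (hv : v ∉ A) :
    (G.neighborFinset v ∩ A).card ≤ cutDeg G A := by
  refine card_le_card_of_injOn (fun x => (x, v)) (fun x hx => ?_)
    (fun x _ y _ h => by simpa using h)
  simp only [coe_inter, Set.mem_inter_iff, mem_coe, SimpleGraph.mem_neighborFinset] at hx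
  simp [hx.2, hv, hx.1.symm]

lemma degree_sdiff_le_cutDeg {α : Type*} [Fintype α] [DecidableEq α]
    (G : SimpleGraph α) [DecidableRel G.Adj] (v : α) (A : Finset α) :
    (G.neighborFinset v \ A).card ≤ cutDeg G (insert v A) := by
  refine card_le_card_of_injOn (fun x => (v, x)) (fun x hx => ?_)
    (fun x _ y _ h => by simpa using h)
  simp only [coe_sdiff, Set.mem_sdiff, mem_coe, SimpleGraph.mem_neighborFinset] at hx
  simp [hx.2, hx.1, hx.1.ne']

lemma degree_inter_lt_cutDeg {α : Type*} [Fintype α] [DecidableEq α]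
    (G : SimpleGraph α) [DecidableRel G.Adj] {v u w : α} {A : Finset α} (hv : v ∉ A)
    (hu : u ∈ A) (hw : w ∉ insert v A) (huw : G.Adj u w) :
    (G.neighborFinset v ∩ A).card < cutDeg G A := by
  rw [mem_insert, not_or] at hw
  rw [← card_image_of_injective _ (Prod.mk_left_injective v)]
  refine card_lt_card (ssubset_iff_of_subset (fun e he => ?_) |>.2 ⟨(u, w), ?_, ?_⟩)
  · obtain ⟨x, hx, rfl⟩ := mem_image.1 he
    simp only [mem_inter, SimpleGraph.mem_neighborFinset] at hx
    simp [hx.2, hv, hx.1.symm]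
  · simp [hu, hw.2, huw]
  · simp [Ne.symm hw.1]

lemma degree_sdiff_lt_cutDeg {α : Type*} [Fintype α] [DecidableEq α]
    (G : SimpleGraph α) [DecidableRel G.Adj] {v u w : α} {A : Finset α} (hv : v ∉ A)
    (hu : u ∈ A) (hw : w ∉ insert v A) (huw : G.Adj u w) :
    (G.neighborFinset v \ A).card < cutDeg G (insert v A) := by
  rw [← card_image_of_injective _ (Prod.mk_right_injective v)]
  refine card_lt_card (ssubset_iff_of_subset (fun e he => ?_) |>.2 ⟨(u, w), ?_, ?_⟩)
  · obtain ⟨x, hx, rfl⟩ := mem_image.1 he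
    simp only [mem_sdiff, SimpleGraph.mem_neighborFinset] at hx
    simp [hx.2, hx.1, hx.1.ne']
  · rw [mem_insert, not_or] at hw
    simp [hu, hw, huw]
  · have : v ≠ u := fun h => hv (h ▸ hu)
    simp [this]

lemma exists_adj_of_not_isCutVertex_s10 {α : Type*} [DecidableEq α]
    (G : SimpleGraph α) {v a b : α} (hcut : ¬ IsCutVertex G v) {A : Finset α} (hv : v ∉ A)
    (ha : a ∈ A) (hb : b ∉ insert v A) :
    ∃ u w, u ∈ A ∧ w ∉ insert v A ∧ G.Adj u w := by
  have hc : (SimpleGraph.induce ({v}ᶜ : Set α) G).Connected := not_not.1 hcut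
  rw [mem_insert, not_or] at hb
  have hav : a ∈ ({v}ᶜ : Set α) := fun h => hv (Set.mem_singleton_iff.1 h ▸ ha)
  obtain ⟨p⟩ := hc.preconnected ⟨a, hav⟩ ⟨b, hb.1⟩
  obtain ⟨d, -, h1, h2⟩ := p.exists_boundary_dart {x | (x : α) ∈ A} ha hb.2
  exact ⟨d.fst, d.snd, h1, by simpa using ⟨d.snd.2, h2⟩, d.adj⟩

/-- Around the position of a non-cut vertex of degree `3`, some prefix has cut at least `3`. -/
lemma three_le_alphaA {α : Type*} [Fintype α] [DecidableEq α]
    (G : SimpleGraph α) [DecidableRel G.Adj] {v : α} (hdeg : G.degree v = 3)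
    (hcut : ¬ IsCutVertex G v) {n : ℕ} (φ : α ≃ Fin n) : 3 ≤ alphaA G φ := by
  set A := prefixSet φ (φ v) with hA
  have hv : v ∉ A := by simp [hA, prefixSet]
  have hins : prefixSet φ (φ v + 1) = insert v A := by
    ext x
    simp only [hA, prefixSet, mem_filter, mem_univ, true_and, mem_insert, Nat.lt_succ_iff_lt_or_eq,
      ← Fin.ext_iff, φ.injective.eq_iff, or_comm]
  have hlt := (φ v).isLt
  have hcard : (G.neighborFinset v ∩ A).card + (G.neighborFinset v \ A).card = 3 := by
    rw [card_inter_add_card_sdiff, SimpleGraph.card_neighborFinset_eq_degree, hdeg]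
  have hsucc : cutDeg G (insert v A) ≤ alphaA G φ := by
    rw [← hins]
    exact le_sup (f := fun i => cutDeg G (prefixSet φ i)) (mem_Icc.2 ⟨by omega, by omega⟩)
  rcases A.eq_empty_or_nonempty with h0 | ⟨a, ha⟩
  · have := degree_sdiff_le_cutDeg G v A
    have : (G.neighborFinset v ∩ A).card = 0 := by simp [h0]
    omega
  have hpos : 0 < (φ v : ℕ) := by
    have : (φ a : ℕ) < φ v := by simpa [hA, prefixSet] using ha
    omega
  have hself : cutDeg G A ≤ alphaA G φ :=
    le_sup (f := fun i => cutDeg G (prefixSet φ i)) (mem_Icc.2 ⟨hpos, hlt.le⟩)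
  by_cases hall : ∃ b, b ∉ insert v A
  · obtain ⟨b, hb⟩ := hall
    obtain ⟨u, w, hu, hw, huw⟩ := exists_adj_of_not_isCutVertex_s10 G hcut hv ha hb
    have := degree_inter_lt_cutDeg G hv hu hw huw
    have := degree_sdiff_lt_cutDeg G hv hu hw huw
    omega
  · push Not at hall
    have hz : (G.neighborFinset v \ A).card = 0 := by
      rw [card_eq_zero, sdiff_eq_empty_iff_subset]
      intro x hx
      exact mem_of_mem_insert_of_ne (hall x) ((G.mem_neighborFinset v x).1 hx).ne'
    have := degree_inter_le_cutDeg G hv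
    omega

lemma cutDeg_singleton_le {α : Type*} [Fintype α] [DecidableEq α]
    (G : SimpleGraph α) [DecidableRel G.Adj] (v : α) : cutDeg G {v} ≤ G.degree v := by
  rw [← SimpleGraph.card_neighborFinset_eq_degree]
  refine card_le_card_of_injOn Prod.snd (fun e he => ?_) (fun e he f hf h => ?_)
  · simp only [mem_coe, mem_filter, mem_univ, true_and, mem_singleton] at he
    simpa [← he.1] using he.2.2
  · simp only [mem_coe, mem_filter, mem_univ, true_and, mem_singleton] at he hf
    exact Prod.ext (he.1.trans hf.1.symm) h

lemma alphaA_le_alphaL {α : Type*} [Fintype α] [DecidableEq α]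
    (G : SimpleGraph α) [DecidableRel G.Adj] {n : ℕ} (φ : α ≃ Fin n) :
    alphaA G φ ≤ alphaL G φ := by
  refine Finset.sup_le fun i hi => ?_
  obtain ⟨h1, hn⟩ := mem_Icc.1 hi
  rcases h1.eq_or_lt with rfl | h2
  · have hp : prefixSet φ 1 = {φ.symm ⟨0, hn⟩} := by
      ext x
      simp [prefixSet, Equiv.eq_symm_apply, Fin.ext_iff]
    rw [hp]
    exact ((cutDeg_singleton_le G _).trans
      (le_sup (f := fun v => G.degree v) (mem_univ _))).trans (le_max_left _ _)
  · exact (le_sup (f := fun j => cutDeg G (prefixSet φ j)) (mem_Icc.2 ⟨h2, hn⟩)).trans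
      (le_max_right _ _)

lemma alphaL_eq_alphaA {α : Type*} [Fintype α] [DecidableEq α]
    (G : SimpleGraph α) [DecidableRel G.Adj] (hdeg : ∀ v, G.degree v ≤ 3) {v : α}
    (hv : G.degree v = 3) (hcut : ¬ IsCutVertex G v) {n : ℕ} (φ : α ≃ Fin n) :
    alphaL G φ = alphaA G φ :=
  le_antisymm
    (max_le (Finset.sup_le fun w _ => (hdeg w).trans (three_le_alphaA G hv hcut φ))
      (sup_mono (Icc_subset_Icc_left one_le_two)))
    (alphaA_le_alphaL G φ)

/-- Let `G` be a simple connected graph, all degrees `≤ 3`, with a vertex of degree `3`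
that is not a cut vertex.  For every linear arrangement `φ` whose first vertex has degree
at most that of its second vertex: (a) `α_L(G,φ) = α_A(G,φ)`; (b) `φ` minimizes `α_L`
over all linear arrangements iff it minimizes `α_A` over all linear arrangements. -/
theorem stmt10 {α : Type*} [Fintype α] [DecidableEq α]
    (G : SimpleGraph α) [DecidableRel G.Adj]
    (hconn : G.Connected) (hdeg : ∀ v, G.degree v ≤ 3)
    (v₀ : α) (hv₀deg : G.degree v₀ = 3) (hv₀cut : ¬ IsCutVertex G v₀)
    (n : ℕ) (hn : Fintype.card α = n) (φ : α ≃ Fin n)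
    (hfirst : ∀ v₁ v₂, (φ v₁ : ℕ) = 0 → (φ v₂ : ℕ) = 1 → G.degree v₁ ≤ G.degree v₂) :
    alphaL G φ = alphaA G φ ∧
    ((∀ ψ : α ≃ Fin n, alphaL G φ ≤ alphaL G ψ) ↔
      (∀ ψ : α ≃ Fin n, alphaA G φ ≤ alphaA G ψ)) := by
  have h := fun ψ : α ≃ Fin n => alphaL_eq_alphaA G hdeg hv₀deg hv₀cut ψ
  exact ⟨h φ, by simp only [h]⟩
end

section
/- Let B be a binary tree over a finite set V with |V| = n ≥ 2, and let S ⊆ B be a collection of at least two clusters that are pairwise disjoint and that is maximal with respect to inclusion among pairwise-disjoint subfamilies of B. Then S is a partition of V: its members are nonempty, pairwise disjoint, and their union is V. -/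
/-- A binary tree over a finite set `V`: a collection `B` of nonempty subsets of `V`
(called clusters) such that every singleton is in `B`, `V` itself is in `B`, and every
cluster `X ≠ V` has a unique `Y ∈ B` disjoint from `X` with `X ∪ Y ∈ B`. -/
def IsBinaryTree {α : Type*} [DecidableEq α] (V : Finset α) (B : Finset (Finset α)) : Prop :=
  (∀ X ∈ B, X ⊆ V ∧ X.Nonempty) ∧
  (∀ v ∈ V, ({v} : Finset α) ∈ B) ∧
  V ∈ B ∧
  ∀ X ∈ B, X ≠ V → ∃! Y, Y ∈ B ∧ Disjoint X Y ∧ X ∪ Y ∈ B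

/-- A maximal pairwise-disjoint subfamily `S` of at least two clusters of a binary tree `B`
over `V` (a "cross-section") is a partition of `V`: its members are nonempty, pairwise
disjoint, and their union is `V`. -/
theorem stmt19 {α : Type*} [DecidableEq α] (V : Finset α) (B : Finset (Finset α))
    (hV : 2 ≤ V.card) (hB : IsBinaryTree V B)
    (S : Finset (Finset α)) (hSB : S ⊆ B) (hS2 : 2 ≤ S.card)
    (hdisj : ∀ X ∈ S, ∀ Y ∈ S, X ≠ Y → Disjoint X Y)
    (hmax : ∀ T : Finset (Finset α), T ⊆ B → S ⊆ T →
      (∀ X ∈ T, ∀ Y ∈ T, X ≠ Y → Disjoint X Y) → T = S) :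
    (∀ X ∈ S, X.Nonempty) ∧
    (∀ X ∈ S, ∀ Y ∈ S, X ≠ Y → Disjoint X Y) ∧
    S.sup id = V := by
  obtain ⟨hsub, hsing, -, -⟩ := hB
  refine ⟨fun X hX => (hsub X (hSB hX)).2, hdisj, ?_⟩
  refine le_antisymm (Finset.sup_le fun X hX => (hsub X (hSB hX)).1) fun v hv => ?_
  by_contra hcov
  have hnot : ∀ X ∈ S, v ∉ X := fun X hX hvX => hcov (Finset.mem_sup.2 ⟨X, hX, hvX⟩)
  have hins : insert {v} S = S := by
    refine hmax _ (Finset.insert_subset (hsing v hv) hSB) (Finset.subset_insert _ _) ?_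
    intro X hX Y hY hXY
    rcases Finset.mem_insert.1 hX with rfl | hX <;> rcases Finset.mem_insert.1 hY with rfl | hY
    · exact absurd rfl hXY
    · exact Finset.disjoint_singleton_left.2 (hnot Y hY)
    · exact Finset.disjoint_singleton_right.2 (hnot X hX)
    · exact hdisj X hX Y hY hXY
  exact hnot {v} (Finset.insert_eq_self.1 hins) (Finset.mem_singleton_self v)
end
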